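/- For every x ∈ D(B*) with x ≠ 0, there exists a unique real number p(x) ∈ (d, ∞) such that s(p(x))[x] = 0, and this unique zero satisfies p(x) ≥ a. -/

import Mathlib

open scoped ComplexInnerProductSpace

/-- The Schur complement quadratic form
`s(λ)[x] = ⟨(A − λ)x, x⟩ − ⟨(D − λ)⁻¹ B*x, B*x⟩` for `x ∈ D(B*)`. -/
noncomputable def schurForm {H : Type*} [NormedAddCommGroup H] [InnerProductSpace ℂ H]
    [CompleteSpace H] (A D : H →L[ℂ] H) (B : H →ₗ.[ℂ] H) (lam : ℂ)
    (x : B.adjoint.domain) : ℂ :=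
  ⟪(A - lam • (1 : H →L[ℂ] H)) (x : H), (x : H)⟫
    - ⟪(Ring.inverse (D - lam • (1 : H →L[ℂ] H))) (B.adjoint x), B.adjoint x⟫

theorem specset {H : Type*} [NormedAddCommGroup H] [InnerProductSpace ℂ H] [CompleteSpace H]
    (D : H →L[ℂ] H) : {r : ℝ | (r : ℂ) ∈ spectrum ℂ D} = spectrum ℝ D := by
  exact spectrum.preimage_algebraMap (S := ℂ) (R := ℝ) (a := D)

theorem upper {H : Type*} [NormedAddCommGroup H] [InnerProductSpace ℂ H] [CompleteSpace H]
    (D : H →L[ℂ] H) (hD : IsSelfAdjoint D) (u : H) :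
    (⟪D u, u⟫).re ≤ (sSup {r : ℝ | (r : ℂ) ∈ spectrum ℂ D}) * ‖u‖^2 := by
  rw [specset]
  have hb : BddAbove (spectrum ℝ D) := (spectrum.isCompact D).bddAbove
  have h : D ≤ algebraMap ℝ (H →L[ℂ] H) (sSup (spectrum ℝ D)) :=
    le_algebraMap_of_spectrum_le (fun t ht => le_csSup hb ht)
  have h2 := ((ContinuousLinearMap.le_def _ _).1 h).re_inner_nonneg_left u
  have h3 : (⟪(sSup (spectrum ℝ D)) • u, u⟫).re = sSup (spectrum ℝ D) * ‖u‖^2 := by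
    rw [RCLike.real_smul_eq_coe_smul (K := ℂ), inner_smul_left, inner_self_eq_norm_sq_to_K]
    simp [← Complex.ofReal_pow]
  simp [Algebra.algebraMap_eq_smul_one, inner_sub_left] at h2
  linarith

theorem lower {H : Type*} [NormedAddCommGroup H] [InnerProductSpace ℂ H] [CompleteSpace H]
    (D : H →L[ℂ] H) (hD : IsSelfAdjoint D) (u : H) :
    (sInf {r : ℝ | (r : ℂ) ∈ spectrum ℂ D}) * ‖u‖^2 ≤ (⟪D u, u⟫).re := by
  rw [specset]
  have hb : BddBelow (spectrum ℝ D) := (spectrum.isCompact D).bddBelow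
  have h : algebraMap ℝ (H →L[ℂ] H) (sInf (spectrum ℝ D)) ≤ D :=
    algebraMap_le_of_le_spectrum (fun t ht => csInf_le hb ht)
  have h2 := ((ContinuousLinearMap.le_def _ _).1 h).re_inner_nonneg_left u
  have h3 : (⟪(sInf (spectrum ℝ D)) • u, u⟫).re = sInf (spectrum ℝ D) * ‖u‖^2 := by
    rw [RCLike.real_smul_eq_coe_smul (K := ℂ), inner_smul_left, inner_self_eq_norm_sq_to_K]
    simp [← Complex.ofReal_pow]
  simp [Algebra.algebraMap_eq_smul_one, inner_sub_left] at h2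
  linarith

theorem isunit {H : Type*} [NormedAddCommGroup H] [InnerProductSpace ℂ H] [CompleteSpace H]
    (D : H →L[ℂ] H) (q : ℝ) (hq : sSup {r : ℝ | (r : ℂ) ∈ spectrum ℂ D} < q) :
    IsUnit (D - (q:ℂ) • (1 : H →L[ℂ] H)) := by
  have hb : BddAbove {r : ℝ | (r : ℂ) ∈ spectrum ℂ D} := by
    rw [specset]; exact (spectrum.isCompact D).bddAbove
  have h : (q:ℂ) ∉ spectrum ℂ D := fun h => absurd (le_csSup hb h) (not_le.2 hq)
  rw [spectrum.notMem_iff, Algebra.algebraMap_eq_smul_one] at h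
  rw [← neg_sub]; exact h.neg

theorem selfadj_shift {H : Type*} [NormedAddCommGroup H] [InnerProductSpace ℂ H] [CompleteSpace H]
    (D : H →L[ℂ] H) (hD : IsSelfAdjoint D) (q : ℝ) :
    IsSelfAdjoint (D - (q:ℂ) • (1 : H →L[ℂ] H)) := by
  refine hD.sub ?_
  rw [isSelfAdjoint_iff, star_smul]
  simp

theorem im_zero {H : Type*} [NormedAddCommGroup H] [InnerProductSpace ℂ H] [CompleteSpace H]
    (D : H →L[ℂ] H) (hD : IsSelfAdjoint D) (u : H) : (⟪D u, u⟫).im = 0 := by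
  exact hD.isSymmetric.im_inner_apply_self u

theorem im_zero_inv {H : Type*} [NormedAddCommGroup H] [InnerProductSpace ℂ H] [CompleteSpace H]
    (D : H →L[ℂ] H) (hD : IsSelfAdjoint D) (hu : IsUnit D) (u : H) :
    (⟪Ring.inverse D u, u⟫).im = 0 := by
  have h : D (Ring.inverse D u) = u := by
    have := Ring.mul_inverse_cancel D hu
    exact congrArg (fun T : H →L[ℂ] H => T u) this
  have h1 := im_zero D hD (Ring.inverse D u)
  rw [h] at h1
  rw [← inner_conj_symm, Complex.conj_im, h1, neg_zero]

theorem shift_re {H : Type*} [NormedAddCommGroup H] [InnerProductSpace ℂ H] [CompleteSpace H]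
    (D : H →L[ℂ] H) (q : ℝ) (u : H) :
    (⟪(D - (q:ℂ) • (1 : H →L[ℂ] H)) u, u⟫).re = (⟪D u, u⟫).re - q * ‖u‖^2 := by
  simp [inner_sub_left, inner_smul_left, inner_self_eq_norm_sq_to_K, ← Complex.ofReal_pow]

/-- monotonicity of the resolvent form -/
theorem res_mono {H : Type*} [NormedAddCommGroup H] [InnerProductSpace ℂ H] [CompleteSpace H]
    (D : H →L[ℂ] H) (hD : IsSelfAdjoint D) (p q : ℝ)
    (hp : sSup {r : ℝ | (r : ℂ) ∈ spectrum ℂ D} < p) (hpq : p ≤ q) (y : H) :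
    (⟪Ring.inverse (D - (p:ℂ) • (1 : H →L[ℂ] H)) y, y⟫).re
      ≤ (⟪Ring.inverse (D - (q:ℂ) • (1 : H →L[ℂ] H)) y, y⟫).re := by
  have hup := isunit D p hp
  have huq := isunit D q (hp.trans_le hpq)
  set S := D - (p:ℂ) • (1 : H →L[ℂ] H) with hS
  set T := D - (q:ℂ) • (1 : H →L[ℂ] H) with hT
  set w := Ring.inverse S y with hw
  set v := Ring.inverse T y with hv
  have h1 : S w = y := congrArg (fun T : H →L[ℂ] H => T y) (Ring.mul_inverse_cancel S hup)
  have h2 : T v = y := congrArg (fun T : H →L[ℂ] H => T y) (Ring.mul_inverse_cancel T huq)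
  have h3 : (⟪S (w - v), w - v⟫).re ≤ 0 := by
    rw [hS, shift_re]
    have := upper D hD (w - v)
    nlinarith [sq_nonneg ‖w - v‖]
  have h4 : (⟪S v, v⟫).re = (⟪y, v⟫).re + (q - p) * ‖v‖^2 := by
    have e1 := shift_re D p v
    have e2 := shift_re D q v
    rw [← hS] at e1
    rw [← hT, h2] at e2
    linarith
  have h5 : ⟪S v, w⟫ = ⟪v, y⟫ := by
    rw [← h1]
    exact (selfadj_shift D hD p).isSymmetric v w
  have h6 : (⟪y, v⟫).re = (⟪v, y⟫).re := inner_re_symm (𝕜 := ℂ) y v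
  have h7 : (⟪y, w⟫).re = (⟪w, y⟫).re := inner_re_symm (𝕜 := ℂ) y w
  rw [map_sub, inner_sub_left, inner_sub_right, inner_sub_right, h1, h5] at h3
  simp only [Complex.sub_re] at h3
  nlinarith [mul_nonneg (sub_nonneg.2 hpq) (sq_nonneg ‖v‖)]

theorem res_nonpos {H : Type*} [NormedAddCommGroup H] [InnerProductSpace ℂ H] [CompleteSpace H]
    (D : H →L[ℂ] H) (hD : IsSelfAdjoint D) (p : ℝ)
    (hp : sSup {r : ℝ | (r : ℂ) ∈ spectrum ℂ D} < p) (y : H) :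
    (⟪Ring.inverse (D - (p:ℂ) • (1 : H →L[ℂ] H)) y, y⟫).re ≤ 0 := by
  have hup := isunit D p hp
  set S := D - (p:ℂ) • (1 : H →L[ℂ] H) with hS
  set w := Ring.inverse S y with hw
  have h1 : S w = y := congrArg (fun T : H →L[ℂ] H => T y) (Ring.mul_inverse_cancel S hup)
  have e1 := shift_re D p w
  rw [← hS, h1] at e1
  have h7 : (⟪y, w⟫).re = (⟪w, y⟫).re := inner_re_symm (𝕜 := ℂ) y w
  have := upper D hD w
  nlinarith [sq_nonneg ‖w‖]

theorem res_cont {H : Type*} [NormedAddCommGroup H] [InnerProductSpace ℂ H] [CompleteSpace H]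
    (D : H →L[ℂ] H) (p : ℝ)
    (hp : sSup {r : ℝ | (r : ℂ) ∈ spectrum ℂ D} < p) (y : H) :
    ContinuousAt (fun p : ℝ => (⟪Ring.inverse (D - (p:ℂ) • (1 : H →L[ℂ] H)) y, y⟫).re) p := by
  obtain ⟨U, hU⟩ := isunit D p hp
  have h0 := NormedRing.inverse_continuousAt U
  rw [hU] at h0
  have h1 : ContinuousAt (fun p : ℝ => D - (p:ℂ) • (1 : H →L[ℂ] H)) p := by fun_prop
  have h2 : ContinuousAt (fun p : ℝ => Ring.inverse (D - (p:ℂ) • (1 : H →L[ℂ] H))) p :=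
    ContinuousAt.comp (f := fun p : ℝ => D - (p:ℂ) • (1 : H →L[ℂ] H)) h0 h1
  have h3 : ContinuousAt (fun p : ℝ => Ring.inverse (D - (p:ℂ) • (1 : H →L[ℂ] H)) y) p :=
    h2.clm_apply continuousAt_const
  exact Complex.continuous_re.continuousAt.comp (ContinuousAt.inner (𝕜 := ℂ) h3 continuousAt_const)

theorem stmt4 {H : Type*} [NormedAddCommGroup H] [InnerProductSpace ℂ H] [CompleteSpace H]
    (A D : H →L[ℂ] H) (hA : IsSelfAdjoint A) (hD : IsSelfAdjoint D)
    (B : H →ₗ.[ℂ] H) (hBdense : Dense (B.domain : Set H)) (hBclosed : B.IsClosed)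
    (a d : ℝ)
    (ha : a = sInf {r : ℝ | (r : ℂ) ∈ spectrum ℂ A})
    (hd : d = sSup {r : ℝ | (r : ℂ) ∈ spectrum ℂ D})
    (hda : d < a)
    (x : B.adjoint.domain) (hx : (x : H) ≠ 0) :
    ∃ p : ℝ, d < p ∧ a ≤ p ∧ schurForm A D B (p : ℂ) x = 0
      ∧ ∀ q : ℝ, d < q → schurForm A D B (q : ℂ) x = 0 → q = p := by
  set y := B.adjoint x with hy
  set g : ℝ → ℝ := fun p => (⟪Ring.inverse (D - (p:ℂ) • (1 : H →L[ℂ] H)) y, y⟫).re with hg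
  have hform : ∀ p : ℝ, d < p → (schurForm A D B (p : ℂ) x = 0 ↔
      (⟪A (x:H), (x:H)⟫).re - p * ‖(x:H)‖^2 - g p = 0) := by
    intro p hp
    have e1 : (schurForm A D B (p : ℂ) x).re = (⟪A (x:H), (x:H)⟫).re - p * ‖(x:H)‖^2 - g p := by
      rw [← shift_re]; rfl
    have e2 : (schurForm A D B (p : ℂ) x).im = 0 := by
      unfold schurForm
      rw [Complex.sub_im, im_zero _ (selfadj_shift A hA p),
        im_zero_inv _ (selfadj_shift D hD p) (isunit D p (hd ▸ hp)), sub_zero]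
    rw [Complex.ext_iff, e1, e2]
    simp
  have hn : 0 < ‖(x:H)‖^2 := by positivity
  have hmono : ∀ p q : ℝ, d < p → p ≤ q → g p ≤ g q := fun p q hp hpq =>
    res_mono D hD p q (hd ▸ hp) hpq y
  have hlow := lower A hA (x:H)
  rw [← ha] at hlow
  set α := (⟪A (x:H), (x:H)⟫).re with hα
  have hga : g a ≤ 0 := res_nonpos D hD a (hd ▸ hda) y
  set M := a + (α - a * ‖(x:H)‖^2 - g a) / ‖(x:H)‖^2 with hM
  have haM : a ≤ M := by
    have : 0 ≤ (α - a * ‖(x:H)‖^2 - g a) / ‖(x:H)‖^2 := div_nonneg (by linarith) hn.le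
    linarith
  have hMv : M * ‖(x:H)‖^2 = α - g a := by
    rw [hM]; field_simp; ring
  have hc : ContinuousOn (fun p : ℝ => α - p * ‖(x:H)‖^2 - g p) (Set.Icc a M) := by
    intro p hp
    apply ContinuousAt.continuousWithinAt
    have : ContinuousAt g p := res_cont D p (hd ▸ hda.trans_le hp.1) y
    exact ContinuousAt.sub (by fun_prop) this
  have hivt := intermediate_value_Icc' haM hc
  obtain ⟨p, hp, hp0⟩ := hivt (show (0:ℝ) ∈ _ from
    ⟨by have := hmono a M hda haM; linarith, by linarith⟩)
  have hdp := hda.trans_le hp.1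
  refine ⟨p, hdp, hp.1, (hform p hdp).2 hp0, ?_⟩
  intro q hq hq0
  have hq1 := (hform q hq).1 hq0
  simp only at hp0
  rcases lt_trichotomy q p with h | h | h
  · have := hmono q p hq h.le
    nlinarith [mul_pos (sub_pos.2 h) hn]
  · exact h
  · have := hmono p q hdp h.le
    nlinarith [mul_pos (sub_pos.2 h) hn]
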